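/- For every N ≥ 2 and every truncated stopping rule ψ ∈ 𝓕ᴺ, R_N(ψ) ≥ Q₀ᴺ. -/

import Mathlib

open MeasureTheory ENNReal Filter ProbabilityTheory

namespace SDP

variable {Θ X D : Type*} [MeasurableSpace Θ] [MeasurableSpace X] [MeasurableSpace D]

/-- The product measure `μⁿ` on `Xⁿ`. -/
noncomputable def pm (μ : Measure X) (n : ℕ) : Measure (Fin n → X) :=
  Measure.pi fun _ => μ

/-- `t_n^ψ = (1-ψ₁)⋯(1-ψ_{n-1})`, with `t₁^ψ ≡ 1`. -/
noncomputable def t (ψ : ∀ n, (Fin n → X) → ℝ≥0∞) : ∀ n, (Fin n → X) → ℝ≥0∞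
  | 0, _ => 1
  | 1, _ => 1
  | n + 2, x => t ψ (n + 1) (Fin.init x) * (1 - ψ (n + 1) (Fin.init x))

/-- `s_n^ψ = (1-ψ₁)⋯(1-ψ_{n-1})ψ_n`. -/
noncomputable def s (ψ : ∀ n, (Fin n → X) → ℝ≥0∞) (n : ℕ) (x : Fin n → X) : ℝ≥0∞ :=
  t ψ n x * ψ n x

/-- A stopping rule: a sequence of measurable functions with values in `[0,1]`. -/
def IsStoppingRule (ψ : ∀ n, (Fin n → X) → ℝ≥0∞) : Prop :=
  (∀ n, Measurable (ψ n)) ∧ ∀ n x, ψ n x ≤ 1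

/-- A decision rule: a sequence of measurable functions with values in `D`. -/
def IsDecisionRule (δ : ∀ n, (Fin n → X) → D) : Prop := ∀ n, Measurable (δ n)

/-- `ψ` is truncated at `N`: `ψ_n ≡ 1` for all `n ≥ N`. -/
def TruncatedAt (ψ : ∀ n, (Fin n → X) → ℝ≥0∞) (N : ℕ) : Prop :=
  ∀ n, N ≤ n → ∀ x, ψ n x = 1

/-- A consistent family of joint probability densities `f_θⁿ` w.r.t. `μⁿ`. -/
def IsDensityFamily (μ : Measure X) (f : Θ → ∀ n, (Fin n → X) → ℝ≥0∞) : Prop :=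
  (∀ n, Measurable fun p : Θ × (Fin n → X) => f p.1 n p.2) ∧
  (∀ θ x, f θ 0 x = 1) ∧
  (∀ θ n, ∫⁻ x, f θ n x ∂pm μ n = 1) ∧
  ∀ θ n (x : Fin n → X), ∫⁻ y, f θ (n + 1) (Fin.snoc x y) ∂μ = f θ n x

/-- The average loss `W(ψ,δ)`. -/
noncomputable def W (π₁ : Measure Θ) (μ : Measure X) (w : Θ → D → ℝ≥0∞)
    (f : Θ → ∀ n, (Fin n → X) → ℝ≥0∞) (ψ : ∀ n, (Fin n → X) → ℝ≥0∞)
    (δ : ∀ n, (Fin n → X) → D) : ℝ≥0∞ :=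
  ∑' n : ℕ, ∫⁻ θ, ∫⁻ x, s ψ (n + 1) x * w θ (δ (n + 1) x) * f θ (n + 1) x ∂pm μ (n + 1) ∂π₁

/-- The partial average loss `W_i(ψ,δ)` (integration over `Θᵢ`). -/
noncomputable def Wi (π₁ : Measure Θ) (μ : Measure X) (w : Θ → D → ℝ≥0∞)
    (f : Θ → ∀ n, (Fin n → X) → ℝ≥0∞) (Θi : Set Θ) (ψ : ∀ n, (Fin n → X) → ℝ≥0∞)
    (δ : ∀ n, (Fin n → X) → D) : ℝ≥0∞ :=
  ∑' n : ℕ,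
    ∫⁻ θ in Θi, ∫⁻ x, s ψ (n + 1) x * w θ (δ (n + 1) x) * f θ (n + 1) x ∂pm μ (n + 1) ∂π₁

/-- `P^{π}(τ_ψ = n)`. -/
noncomputable def PtauEq (π₂ : Measure Θ) (μ : Measure X)
    (f : Θ → ∀ n, (Fin n → X) → ℝ≥0∞) (ψ : ∀ n, (Fin n → X) → ℝ≥0∞) (n : ℕ) : ℝ≥0∞ :=
  ∫⁻ θ, ∫⁻ x, s ψ n x * f θ n x ∂pm μ n ∂π₂

/-- `P^{π}(τ_ψ < ∞)`. -/
noncomputable def Pfin (π₂ : Measure Θ) (μ : Measure X)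
    (f : Θ → ∀ n, (Fin n → X) → ℝ≥0∞) (ψ : ∀ n, (Fin n → X) → ℝ≥0∞) : ℝ≥0∞ :=
  ∑' n : ℕ, PtauEq π₂ μ f ψ (n + 1)

/-- The average sample number `N(ψ)` (equal to `∞` if `P^{π₂}(τ_ψ < ∞) < 1`). -/
noncomputable def ASN (π₂ : Measure Θ) (μ : Measure X)
    (f : Θ → ∀ n, (Fin n → X) → ℝ≥0∞) (ψ : ∀ n, (Fin n → X) → ℝ≥0∞) : ℝ≥0∞ :=
  if Pfin π₂ μ f ψ = 1 then ∑' n : ℕ, ((n : ℝ≥0∞) + 1) * PtauEq π₂ μ f ψ (n + 1) else ⊤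

/-- `fⁿ = ∫_Θ f_θⁿ dπ₂(θ)` (in particular `f⁰ ≡ 1`). -/
noncomputable def fbar (π₂ : Measure Θ) (f : Θ → ∀ n, (Fin n → X) → ℝ≥0∞)
    (n : ℕ) (x : Fin n → X) : ℝ≥0∞ :=
  ∫⁻ θ, f θ n x ∂π₂

/-- `R(ψ) = Σₙ ∫ sₙ^ψ (c n fⁿ + lₙ) dμⁿ` if `P^{π₂}(τ_ψ<∞) = 1`, `∞` otherwise. -/
noncomputable def R (π₂ : Measure Θ) (μ : Measure X) (c : ℝ≥0∞)
    (f : Θ → ∀ n, (Fin n → X) → ℝ≥0∞) (l : ∀ n, (Fin n → X) → ℝ≥0∞)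
    (ψ : ∀ n, (Fin n → X) → ℝ≥0∞) : ℝ≥0∞ :=
  if Pfin π₂ μ f ψ = 1 then
    ∑' n : ℕ, ∫⁻ x, s ψ (n + 1) x *
      (c * ((n : ℝ≥0∞) + 1) * fbar π₂ f (n + 1) x + l (n + 1) x) ∂pm μ (n + 1)
  else ⊤

/-- `R_N(ψ)`, the risk of `ψ` truncated at `N`. -/
noncomputable def RN (π₂ : Measure Θ) (μ : Measure X) (c : ℝ≥0∞)
    (f : Θ → ∀ n, (Fin n → X) → ℝ≥0∞) (l : ∀ n, (Fin n → X) → ℝ≥0∞)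
    (N : ℕ) (ψ : ∀ n, (Fin n → X) → ℝ≥0∞) : ℝ≥0∞ :=
  (∑ n ∈ Finset.range (N - 1), ∫⁻ x, s ψ (n + 1) x *
      (c * ((n : ℝ≥0∞) + 1) * fbar π₂ f (n + 1) x + l (n + 1) x) ∂pm μ (n + 1)) +
  ∫⁻ x, t ψ N x * (c * (N : ℝ≥0∞) * fbar π₂ f N x + l N x) ∂pm μ N

/-- `Vₙᴺ`, defined backwards from `V_Nᴺ = l_N` by `Vₙᴺ = min{lₙ, Qₙᴺ}`. -/
noncomputable def V (μ : Measure X) (c : ℝ≥0∞) (fb l : ∀ n, (Fin n → X) → ℝ≥0∞)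
    (N n : ℕ) (x : Fin n → X) : ℝ≥0∞ :=
  if h : n < N then
    min (l n x) (c * fb n x + ∫⁻ y, V μ c fb l N (n + 1) (Fin.snoc x y) ∂μ)
  else l n x
termination_by N - n
decreasing_by omega

/-- `Qₙᴺ = c fⁿ + ∫ Vₙ₊₁ᴺ(⋅,y) dμ(y)`. -/
noncomputable def Q (μ : Measure X) (c : ℝ≥0∞) (fb l : ∀ n, (Fin n → X) → ℝ≥0∞)
    (N n : ℕ) (x : Fin n → X) : ℝ≥0∞ :=
  c * fb n x + ∫⁻ y, V μ c fb l N (n + 1) (Fin.snoc x y) ∂μ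

/-- `Vₙ = lim_{N→∞} Vₙᴺ` (the sequence is nonincreasing in `N`, so the limit is the inf). -/
noncomputable def Vlim (μ : Measure X) (c : ℝ≥0∞) (fb l : ∀ n, (Fin n → X) → ℝ≥0∞)
    (n : ℕ) (x : Fin n → X) : ℝ≥0∞ :=
  ⨅ N, V μ c fb l N n x

/-- `Qₙ = lim_{N→∞} Qₙᴺ = c fⁿ + ∫ Vₙ₊₁(⋅,y) dμ(y)`. -/
noncomputable def Qlim (μ : Measure X) (c : ℝ≥0∞) (fb l : ∀ n, (Fin n → X) → ℝ≥0∞)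
    (n : ℕ) (x : Fin n → X) : ℝ≥0∞ :=
  c * fb n x + ∫⁻ y, Vlim μ c fb l (n + 1) (Fin.snoc x y) ∂μ

end SDP

namespace SDP

variable {X : Type*} [MeasurableSpace X]

theorem lintegral_pm_succ (μ : Measure X) [SigmaFinite μ] (n : ℕ)
    {g : (Fin (n + 1) → X) → ℝ≥0∞} (hg : Measurable g) :
    ∫⁻ z, g z ∂pm μ (n + 1) = ∫⁻ x, ∫⁻ y, g (Fin.snoc x y) ∂μ ∂pm μ n := by
  have hmp := (measurePreserving_piFinSuccAbove (fun _ : Fin (n + 1) => μ) (Fin.last n)).symm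
  unfold pm
  rw [← hmp.lintegral_comp hg]
  refine (lintegral_prod_symm' _ (hg.comp hmp.measurable)).trans ?_
  simp [MeasurableEquiv.piFinSuccAbove, Fin.insertNthEquiv, Fin.insertNth_last']

theorem measurable_snoc (n : ℕ) :
    Measurable fun p : (Fin n → X) × X => (Fin.snoc p.1 p.2 : Fin (n + 1) → X) := by
  refine measurable_pi_lambda _ fun i => ?_
  refine Fin.lastCases ?_ (fun j => ?_) i
  · simpa using measurable_snd
  · simpa [Function.comp_def] using (measurable_pi_apply j).comp measurable_fst

theorem measurable_init (n : ℕ) :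
    Measurable fun x : Fin (n + 1) → X => (Fin.init x : Fin n → X) :=
  measurable_pi_lambda _ fun i => measurable_pi_apply i.castSucc

theorem measurable_t {ψ : ∀ n, (Fin n → X) → ℝ≥0∞} (hψ : ∀ n, Measurable (ψ n)) :
    ∀ n, Measurable (t ψ n)
  | 0 => by
    have : t ψ 0 = fun _ => 1 := by ext x; simp [t]
    rw [this]; exact measurable_const
  | 1 => by
    have : t ψ 1 = fun _ => 1 := by ext x; simp [t]
    rw [this]; exact measurable_const
  | n + 2 => by
    have : t ψ (n + 2) =
        fun x => t ψ (n + 1) (Fin.init x) * (1 - ψ (n + 1) (Fin.init x)) := by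
      ext x; simp [t]
    rw [this]
    exact ((measurable_t hψ (n + 1)).comp (measurable_init _)).mul
      (measurable_const.sub ((hψ (n + 1)).comp (measurable_init _)))

theorem V_of_lt (μ : Measure X) (c : ℝ≥0∞) (fb l : ∀ n, (Fin n → X) → ℝ≥0∞) {N n : ℕ}
    (h : n < N) (x : Fin n → X) : V μ c fb l N n x = min (l n x) (Q μ c fb l N n x) := by
  rw [V, dif_pos h, Q]

theorem V_self (μ : Measure X) (c : ℝ≥0∞) (fb l : ∀ n, (Fin n → X) → ℝ≥0∞) (N : ℕ)
    (x : Fin N → X) : V μ c fb l N N x = l N x := by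
  rw [V, dif_neg (lt_irrefl N)]

theorem measurable_V (μ : Measure X) [SigmaFinite μ] (c : ℝ≥0∞)
    {fb l : ∀ n, (Fin n → X) → ℝ≥0∞} (hfb : ∀ n, Measurable (fb n))
    (hl : ∀ n, Measurable (l n)) {N n : ℕ} (hn : n ≤ N) : Measurable (V μ c fb l N n) := by
  induction hn using Nat.decreasingInduction with
  | self => simpa only [funext (V_self μ c fb l N)] using hl N
  | of_succ n hn ih =>
    rw [funext (V_of_lt μ c fb l hn)]
    exact (hl n).min (((hfb n).const_mul c).add
      (Measurable.lintegral_prod_right' (ih.comp (measurable_snoc n))))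

/-- The marginal densities of a mixture over `θ` are consistent. -/
theorem lintegral_fbar_snoc {Θ : Type*} [MeasurableSpace Θ] {μ : Measure X} [SigmaFinite μ]
    (π : Measure Θ) [SFinite π] {f : Θ → ∀ n, (Fin n → X) → ℝ≥0∞}
    (hf : IsDensityFamily μ f) (n : ℕ) (x : Fin n → X) :
    ∫⁻ y, fbar π f (n + 1) (Fin.snoc x y) ∂μ = fbar π f n x := by
  unfold fbar
  rw [lintegral_lintegral_swap]
  · exact lintegral_congr fun θ => hf.2.2.2 θ n x
  · exact ((hf.1 (n + 1)).comp (measurable_snd.prodMk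
      ((measurable_snoc n).comp (measurable_const.prodMk measurable_fst)))).aemeasurable

/-- Consistency turns the one-step-ahead cost plus value into the current cost plus `Q`. -/
theorem lintegral_cost_add_V {μ : Measure X} [SigmaFinite μ] (c : ℝ≥0∞)
    {fb l : ∀ n, (Fin n → X) → ℝ≥0∞} (hfb : ∀ n, Measurable (fb n))
    (hcons : ∀ n (x : Fin n → X), ∫⁻ y, fb (n + 1) (Fin.snoc x y) ∂μ = fb n x)
    (N n : ℕ) (x : Fin n → X) :
    ∫⁻ y, (c * ((n : ℝ≥0∞) + 1) * fb (n + 1) (Fin.snoc x y) +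
        V μ c fb l N (n + 1) (Fin.snoc x y)) ∂μ = c * n * fb n x + Q μ c fb l N n x := by
  have hm : Measurable fun y => fb (n + 1) (Fin.snoc x y) :=
    (hfb (n + 1)).comp ((measurable_snoc n).comp (measurable_const.prodMk measurable_id))
  rw [lintegral_add_left (hm.const_mul _), lintegral_const_mul _ hm, hcons, Q]
  ring

/-- One step of backward induction: stopping optimally from time `n` on costs at most
as much as using `ψ` at time `n` and stopping optimally afterwards. -/
theorem lintegral_t_mul_le {μ : Measure X} [SigmaFinite μ] (c : ℝ≥0∞)
    {fb l : ∀ n, (Fin n → X) → ℝ≥0∞} (hfb : ∀ n, Measurable (fb n))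
    (hl : ∀ n, Measurable (l n))
    (hcons : ∀ n (x : Fin n → X), ∫⁻ y, fb (n + 1) (Fin.snoc x y) ∂μ = fb n x)
    {ψ : ∀ n, (Fin n → X) → ℝ≥0∞} (hψ : IsStoppingRule ψ) {N n : ℕ} (hn : n + 1 < N) :
    ∫⁻ x, t ψ (n + 1) x * (c * ((n : ℝ≥0∞) + 1) * fb (n + 1) x + V μ c fb l N (n + 1) x)
        ∂pm μ (n + 1) ≤
      ∫⁻ x, s ψ (n + 1) x * (c * ((n : ℝ≥0∞) + 1) * fb (n + 1) x + l (n + 1) x)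
        ∂pm μ (n + 1) +
      ∫⁻ x, t ψ (n + 2) x * (c * ((n : ℝ≥0∞) + 1 + 1) * fb (n + 2) x + V μ c fb l N (n + 2) x)
        ∂pm μ (n + 2) := by
  have ht := measurable_t hψ.1
  have hV := measurable_V μ c hfb hl (show n + 2 ≤ N from hn)
  have hcont : Measurable fun x : Fin (n + 2) → X =>
      c * ((n : ℝ≥0∞) + 1 + 1) * fb (n + 2) x + V μ c fb l N (n + 2) x :=
    ((hfb _).const_mul _).add hV
  have hs : Measurable fun x => s ψ (n + 1) x *
      (c * ((n : ℝ≥0∞) + 1) * fb (n + 1) x + l (n + 1) x) :=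
    ((ht _).mul (hψ.1 _)).mul (((hfb _).const_mul _).add (hl _))
  have hsucc := lintegral_pm_succ μ (n + 1) ((ht _).mul hcont)
  simp only [Pi.mul_apply] at hsucc
  rw [hsucc, ← lintegral_add_left hs]
  refine lintegral_mono fun x => ?_
  have key := lintegral_cost_add_V (l := l) c hfb hcons N (n + 1) x
  push_cast at key
  have hm : Measurable fun y => c * ((n : ℝ≥0∞) + 1 + 1) * fb (n + 2) (Fin.snoc x y) +
      V μ c fb l N (n + 2) (Fin.snoc x y) :=
    hcont.comp ((measurable_snoc _).comp (measurable_const.prodMk measurable_id))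
  simp only [t, Fin.init_snoc, s]
  rw [lintegral_const_mul _ hm, key, V_of_lt μ c fb l hn]
  set A := c * ((n : ℝ≥0∞) + 1) * fb (n + 1) x
  set L := l (n + 1) x
  set q := Q μ c fb l N (n + 1) x
  set T := t ψ (n + 1) x
  set p := ψ (n + 1) x
  calc T * (A + min L q) = T * p * (A + min L q) + T * (1 - p) * (A + min L q) := by
        rw [← add_mul, ← mul_add, add_tsub_cancel_of_le (hψ.2 _ x), mul_one]
    _ ≤ T * p * (A + L) + T * (1 - p) * (A + q) := by
        gcongr
        · exact min_le_left _ _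
        · exact min_le_right _ _

/-- The optimal value at time `m + 1` bounds from below the tail of the risk of any rule. -/
theorem lintegral_t_mul_le_tail {μ : Measure X} [SigmaFinite μ] (c : ℝ≥0∞)
    {fb l : ∀ n, (Fin n → X) → ℝ≥0∞} (hfb : ∀ n, Measurable (fb n))
    (hl : ∀ n, Measurable (l n))
    (hcons : ∀ n (x : Fin n → X), ∫⁻ y, fb (n + 1) (Fin.snoc x y) ∂μ = fb n x)
    {ψ : ∀ n, (Fin n → X) → ℝ≥0∞} (hψ : IsStoppingRule ψ) {M m : ℕ} (hm : m ≤ M) :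
    ∫⁻ x, t ψ (m + 1) x *
        (c * ((m : ℝ≥0∞) + 1) * fb (m + 1) x + V μ c fb l (M + 1) (m + 1) x) ∂pm μ (m + 1) ≤
      ∑ n ∈ Finset.Ico m M, ∫⁻ x, s ψ (n + 1) x *
        (c * ((n : ℝ≥0∞) + 1) * fb (n + 1) x + l (n + 1) x) ∂pm μ (n + 1) +
      ∫⁻ x, t ψ (M + 1) x * (c * ((M : ℝ≥0∞) + 1) * fb (M + 1) x + l (M + 1) x)
        ∂pm μ (M + 1) := by
  induction hm using Nat.decreasingInduction with
  | self => simp [V_self]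
  | of_succ m hm ih =>
    refine (lintegral_t_mul_le c hfb hl hcons hψ (by omega)).trans ?_
    rw [Finset.sum_eq_sum_Ico_succ_bot hm]
    push_cast at ih
    exact (add_le_add le_rfl ih).trans_eq (add_assoc _ _ _).symm

end SDP

open SDP MeasureTheory ENNReal in
/-- for every `N ≥ 2` and every truncated stopping rule `ψ ∈ 𝓕ᴺ`,
`R_N(ψ) ≥ Q₀ᴺ`. -/
theorem statement_4
    {Θ X D : Type*} [MeasurableSpace Θ] [MeasurableSpace X] [MeasurableSpace D]
    (μ : Measure X) [SigmaFinite μ]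
    (π₁ π₂ : Measure Θ) [IsProbabilityMeasure π₁] [IsProbabilityMeasure π₂]
    (f : Θ → ∀ n, (Fin n → X) → ℝ≥0∞) (hf : IsDensityFamily μ f)
    (w : Θ → D → ℝ≥0∞) (hw : Measurable (Function.uncurry w))
    (δB : ∀ n, (Fin n → X) → D) (hδB : IsDecisionRule δB)
    (hBayes : ∀ n (d : D), ∀ᵐ x ∂pm μ n,
      ∫⁻ θ, w θ (δB n x) * f θ n x ∂π₁ ≤ ∫⁻ θ, w θ d * f θ n x ∂π₁)
    (l : ∀ n, (Fin n → X) → ℝ≥0∞)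
    (hl : ∀ n x, l n x = ∫⁻ θ, w θ (δB n x) * f θ n x ∂π₁)
    (hl1 : ∫⁻ x, l 1 x ∂pm μ 1 < ⊤)
    (c : ℝ≥0∞) (hc : 0 < c) (hc' : c ≠ ⊤)
    (N : ℕ) (hN : 2 ≤ N)
    (ψ : ∀ n, (Fin n → X) → ℝ≥0∞) (hψ : IsStoppingRule ψ) (hψN : TruncatedAt ψ N) :
    Q μ c (fbar π₂ f) l N 0 ![] ≤ RN π₂ μ c f l N ψ := by
  obtain ⟨M, rfl⟩ : ∃ M, N = M + 1 := ⟨N - 1, by omega⟩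
  have hfb : ∀ n, Measurable (fbar π₂ f n) := fun n =>
    Measurable.lintegral_prod_left' (hf.1 n)
  have hlm : ∀ n, Measurable (l n) := fun n => by
    rw [funext (hl n)]
    refine Measurable.lintegral_prod_left'
      (f := fun p : Θ × (Fin n → X) => w p.1 (δB n p.2) * f p.1 n p.2) ?_
    exact (hw.comp (measurable_fst.prodMk ((hδB n).comp measurable_snd))).mul (hf.1 n)
  have hcons := lintegral_fbar_snoc π₂ hf
  have hV := measurable_V μ c hfb hlm (show 0 + 1 ≤ M + 1 by omega)
  have main := lintegral_t_mul_le_tail c hfb hlm hcons hψ (Nat.zero_le M)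
  have hstart := lintegral_pm_succ μ 0
    (((hfb (0 + 1)).const_mul (c * (((0 : ℕ) : ℝ≥0∞) + 1))).add hV)
  simp only [Pi.add_apply, lintegral_cost_add_V c hfb hcons] at hstart
  have hdirac : pm μ 0 = Measure.dirac ![] := Measure.pi_of_empty _ _
  have ht1 : ∀ x, t ψ (0 + 1) x = 1 := fun x => by simp [t]
  simp only [ht1, one_mul] at main
  rw [hstart, hdirac, lintegral_dirac] at main
  simpa [RN] using main
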